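/- arXiv:1811.05959 — 2 statements merged into one kernel-verified Lean document; each statement's English description precedes it below -/
import Mathlib

section
/- Let X ⊆ ℝ^N be a Borel set and μ a Borel σ-finite measure on X. Let k ∈ ℕ with k ≤ N and H^k(X) = 0. Then for Lebesgue almost every tuple (l_1,…,l_k) ∈ (ℝ^N)^k the vectors l_1,…,l_k are linearly independent and the orthogonal projection of ℝ^N onto the k-dimensional subspace span{l_1,…,l_k} is injective on some Borel subset of X of full μ-measure. -/
open MeasureTheory Set
open scoped InnerProductSpace ENNReal

/-- A finite measure is carried, on a Borel set, by a σ-compact subset. -/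
lemma pip_exists_compacts {N : ℕ} (X : Set (EuclideanSpace ℝ (Fin N))) (hX : MeasurableSet X)
    (μ : Measure (EuclideanSpace ℝ (Fin N))) [SigmaFinite μ] :
    ∃ K : ℕ → Set (EuclideanSpace ℝ (Fin N)), (∀ n, IsCompact (K n)) ∧ (∀ n, K n ⊆ X) ∧
      μ (X \ ⋃ n, K n) = 0 := by
  have h : ∀ n : ℕ, ∃ K ⊆ X, IsCompact K ∧ μ.toFinite (X \ K) < ((n : ℝ≥0∞) + 1)⁻¹ := by
    intro n
    apply hX.exists_isCompact_sdiff_lt (measure_ne_top _ _)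
    simp
  choose K hKX hK hlt using h
  refine ⟨K, hK, hKX, absolutelyContinuous_toFinite μ ?_⟩
  by_contra hne
  obtain ⟨n, hn⟩ := ENNReal.exists_inv_nat_lt hne
  have h1 : μ.toFinite (X \ ⋃ n, K n) ≤ μ.toFinite (X \ K n) :=
    measure_mono (sdiff_subset_sdiff_right (subset_iUnion K n))
  have h2 : ((n : ℝ≥0∞) + 1)⁻¹ ≤ (n : ℝ≥0∞)⁻¹ := by
    rw [ENNReal.inv_le_inv]; exact le_self_add
  exact absurd (hn.trans_le (h1.trans ((hlt n).le.trans h2))) (lt_irrefl _)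

/-- The bad set of pairs. -/
def pipBad {N : ℕ} (k : ℕ) (Y : Set (EuclideanSpace ℝ (Fin N))) (j : Fin N) :
    Set (EuclideanSpace ℝ (Fin N) × (Fin k → EuclideanSpace ℝ (Fin N))) :=
  {p | p.1 ∈ Y ∧ ∃ y ∈ Y, y j ≠ p.1 j ∧ ∀ i, ⟪p.2 i, y - p.1⟫_ℝ = 0}

lemma pip_measurable_bad {N k : ℕ} (K : ℕ → Set (EuclideanSpace ℝ (Fin N)))
    (hK : ∀ n, IsCompact (K n)) (j : Fin N) :
    MeasurableSet (pipBad k (⋃ n, K n) j) := by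
  let C : ℕ → ℕ → ℕ → Set (EuclideanSpace ℝ (Fin N) ×
      (EuclideanSpace ℝ (Fin N) × (Fin k → EuclideanSpace ℝ (Fin N)))) := fun a b m =>
    {q | q.1 ∈ K a ∧ q.2.1 ∈ K b ∧ 1 / ((m : ℝ) + 1) ≤ |q.1 j - q.2.1 j| ∧
      ∀ i, ⟪q.2.2 i, q.1 - q.2.1⟫_ℝ = 0}
  have hC : ∀ a b m, IsClosed (C a b m) := by
    intro a b m
    have h1 : IsClosed {q : EuclideanSpace ℝ (Fin N) ×
        (EuclideanSpace ℝ (Fin N) × (Fin k → EuclideanSpace ℝ (Fin N))) |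
          1 / ((m : ℝ) + 1) ≤ |q.1 j - q.2.1 j|} :=
      isClosed_le (by fun_prop) (by fun_prop)
    have h2 : ∀ i, IsClosed {q : EuclideanSpace ℝ (Fin N) ×
        (EuclideanSpace ℝ (Fin N) × (Fin k → EuclideanSpace ℝ (Fin N))) |
          ⟪q.2.2 i, q.1 - q.2.1⟫_ℝ = 0} :=
      fun i => isClosed_eq (by fun_prop) (by fun_prop)
    have h3 := ((hK a).isClosed.preimage (continuous_fst (X := EuclideanSpace ℝ (Fin N))
      (Y := EuclideanSpace ℝ (Fin N) × (Fin k → EuclideanSpace ℝ (Fin N))))).inter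
      (((hK b).isClosed.preimage (continuous_fst.comp continuous_snd)).inter
        (h1.inter (isClosed_iInter h2)))
    convert h3 using 1
    ext q
    simp [C]
  have hEq : pipBad k (⋃ n, K n) j = ⋃ a, ⋃ b, ⋃ m, Prod.snd '' (C a b m) := by
    ext ⟨x, l⟩
    simp only [pipBad, mem_ofPred_eq, mem_iUnion, mem_image, C, Prod.exists]
    constructor
    · rintro ⟨⟨b, hb⟩, y, ⟨a, ha⟩, hne, hl⟩
      obtain ⟨m, hm⟩ := exists_nat_one_div_lt (abs_pos.2 (sub_ne_zero.2 hne))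
      exact ⟨a, b, m, y, x, l, ⟨ha, hb, hm.le, hl⟩, rfl⟩
    · rintro ⟨a, b, m, y, x', l', ⟨ha, hb, hm, hl⟩, h⟩
      obtain ⟨rfl, rfl⟩ := Prod.mk.inj h
      refine ⟨⟨b, hb⟩, y, ⟨a, ha⟩, ?_, hl⟩
      have : (0 : ℝ) < 1 / ((m : ℝ) + 1) := by positivity
      exact sub_ne_zero.1 (abs_pos.1 (this.trans_le hm))
  rw [hEq]
  refine MeasurableSet.iUnion fun a => MeasurableSet.iUnion fun b => MeasurableSet.iUnion fun m => ?_
  obtain ⟨T, hT, hTu⟩ := (isSigmaCompact_univ.of_isClosed_subset (hC a b m)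
    (subset_univ _)).image continuous_snd
  rw [← hTu]
  exact MeasurableSet.iUnion fun n => (hT n).measurableSet

/-- `C¹` images of `H^k`-null sets in `ℝ^k` are Lebesgue null. -/
lemma pip_image_null {N k : ℕ} (S : Set (EuclideanSpace ℝ (Fin N)))
    (hS : μH[(k : ℝ)] S = 0) (g : EuclideanSpace ℝ (Fin N) → (Fin k → ℝ))
    (hg : ∀ y ∈ S, ContDiffAt ℝ 1 g y) : (volume : Measure (Fin k → ℝ)) (g '' S) = 0 := by
  have key : (OuterMeasure.comap g (volume : Measure (Fin k → ℝ)).toOuterMeasure) S = 0 := by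
    apply measure_null_of_locally_null
    intro y hy
    obtain ⟨C, t, ht, hL⟩ := (hg y hy).exists_lipschitzOnWith
    refine ⟨t ∩ S, Filter.inter_mem (mem_nhdsWithin_of_mem_nhds ht) self_mem_nhdsWithin, ?_⟩
    rw [OuterMeasure.comap_apply]
    have h1 := (hL.mono (inter_subset_left (t := S))).hausdorffMeasure_image_le
      (d := (k : ℝ)) (Nat.cast_nonneg k)
    rw [measure_mono_null inter_subset_right hS, mul_zero] at h1
    have h2 := hausdorffMeasure_pi_real (ι := Fin k)
    rw [Fintype.card_fin] at h2
    rw [h2] at h1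
    exact le_antisymm h1 bot_le
  simpa [OuterMeasure.comap_apply] using key

lemma pip_section_null {N k : ℕ} (Y : Set (EuclideanSpace ℝ (Fin N)))
    (hY : μH[(k : ℝ)] Y = 0) (j : Fin N) (hm : MeasurableSet (pipBad k Y j))
    (x : EuclideanSpace ℝ (Fin N)) :
    ∀ᵐ l ∂(volume : Measure (Fin k → EuclideanSpace ℝ (Fin N))), (x, l) ∉ pipBad k Y j := by
  let L : (Fin k → ℝ) →ₗ[ℝ] (Fin k → EuclideanSpace ℝ (Fin N)) :=
    LinearMap.pi fun i => (LinearMap.proj i).smulRight (EuclideanSpace.single j (1 : ℝ))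
  have hms : MeasurableSet {l : Fin k → EuclideanSpace ℝ (Fin N) | (x, l) ∉ pipBad k Y j} :=
    (measurable_prodMk_left hm).compl
  refine ae_mem_of_ae_add_linearMap_mem L volume volume hms ?_
  intro l
  let g : EuclideanSpace ℝ (Fin N) → (Fin k → ℝ) := fun y i => -⟪l i, y - x⟫_ℝ / (y j - x j)
  have hnull : (volume : Measure (Fin k → ℝ)) (g '' (Y ∩ {y | y j ≠ x j})) = 0 := by
    apply pip_image_null _ (measure_mono_null inter_subset_left hY)
    rintro y ⟨-, hy⟩
    refine contDiffAt_pi.2 fun i => ?_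
    refine ContDiffAt.div ?_ ?_ (sub_ne_zero.2 hy)
    · exact (contDiffAt_const.inner ℝ (contDiffAt_id.sub contDiffAt_const)).neg
    · fun_prop
  refine measure_mono_null ?_ hnull
  intro t ht
  replace ht : (x, l + L t) ∈ pipBad k Y j := not_not.1 ht
  obtain ⟨-, y, hy, hne, hl⟩ := ht
  refine ⟨y, ⟨hy, hne⟩, ?_⟩
  funext i
  have := hl i
  dsimp only at this hne
  have hL : L t i = t i • EuclideanSpace.single j (1 : ℝ) := rfl
  rw [Pi.add_apply, hL, inner_add_left, inner_smul_left, EuclideanSpace.inner_single_left] at this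
  simp only [map_one, one_mul, PiLp.sub_apply, conj_trivial] at this
  have h0 := sub_ne_zero.2 hne
  simp only [g]
  rw [div_eq_iff h0]
  linarith

lemma pip_ae_linearIndependent {N k : ℕ} (hkN : k ≤ N) :
    ∀ᵐ l ∂(volume : Measure (Fin k → EuclideanSpace ℝ (Fin N))), LinearIndependent ℝ l := by
  let M : (Fin k → EuclideanSpace ℝ (Fin N)) → Matrix (Fin k) (Fin k) ℝ :=
    fun l => Matrix.of fun i j => l i (Fin.castLE hkN j)
  have hMc : Continuous M := by
    refine continuous_matrix fun i j => ?_
    simp only [M, Matrix.of_apply]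
    fun_prop
  have hms : MeasurableSet {l | (M l).det ≠ 0} :=
    (isOpen_ne_fun hMc.matrix_det continuous_const).measurableSet
  let L : ℝ →ₗ[ℝ] (Fin k → EuclideanSpace ℝ (Fin N)) :=
    LinearMap.toSpanSingleton ℝ _ (fun i => EuclideanSpace.single (Fin.castLE hkN i) (1 : ℝ))
  have h : ∀ᵐ l ∂(volume : Measure (Fin k → EuclideanSpace ℝ (Fin N))), l ∈ {l | (M l).det ≠ 0} := by
    refine ae_mem_of_ae_add_linearMap_mem L volume volume hms ?_
    intro l
    have hfin : ((-M l).charpoly.rootSet ℝ).Finite := Polynomial.rootSet_finite _ _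
    refine measure_mono_null ?_ (hfin.measure_zero volume)
    intro t ht
    simp only [mem_compl_iff, mem_ofPred_eq, not_not] at ht
    rw [Polynomial.mem_rootSet]
    refine ⟨(Matrix.charpoly_monic _).ne_zero, ?_⟩
    rw [Polynomial.coe_aeval_eq_eval, Matrix.eval_charpoly, ← ht]
    congr 1
    ext a b
    simp [M, L, Matrix.scalar_apply, Matrix.diagonal_apply, add_comm, eq_comm]
  filter_upwards [h] with l hl
  have hrow := Matrix.linearIndependent_rows_of_det_ne_zero hl
  let P : EuclideanSpace ℝ (Fin N) →ₗ[ℝ] (Fin k → ℝ) :=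
    { toFun := fun x j => x (Fin.castLE hkN j)
      map_add' := fun _ _ => rfl
      map_smul' := fun _ _ => rfl }
  exact LinearIndependent.of_comp P hrow

/-- **Probabilistic injective projection theorem.**
`X ⊆ ℝ^N` Borel, `μ` a Borel σ-finite measure on `X`, `k ≤ N` with `H^k(X) = 0`.
Then for Lebesgue-a.e. tuple `(l₁,…,l_k) ∈ (ℝ^N)^k` the vectors `l₁,…,l_k` are linearly
independent and the orthogonal projection onto `span{l₁,…,l_k}` is injective on some
Borel subset of `X` of full `μ`-measure. -/
theorem probabilistic_injective_projection {N k : ℕ} (hkN : k ≤ N)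
    (X : Set (EuclideanSpace ℝ (Fin N))) (hX : MeasurableSet X)
    (μ : Measure (EuclideanSpace ℝ (Fin N))) [SigmaFinite μ]
    (hμX : μ Xᶜ = 0)
    (hXH : μH[(k : ℝ)] X = 0) :
    ∀ᵐ l ∂(volume : Measure (Fin k → EuclideanSpace ℝ (Fin N))),
      LinearIndependent ℝ l ∧
      ∃ X_L : Set (EuclideanSpace ℝ (Fin N)), X_L ⊆ X ∧ MeasurableSet X_L ∧
        μ (X \ X_L) = 0 ∧
        Set.InjOn (fun x => Submodule.orthogonalProjection (Submodule.span ℝ (Set.range l)) x) X_L := by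
  obtain ⟨K, hK, hKX, hKμ⟩ := pip_exists_compacts X hX μ
  have hYX : (⋃ n, K n) ⊆ X := iUnion_subset hKX
  have hYm : MeasurableSet (⋃ n, K n) := MeasurableSet.iUnion fun n => (hK n).measurableSet
  have hbm := pip_measurable_bad (k := k) K hK
  have hYH := measure_mono_null hYX hXH
  generalize (⋃ n, K n) = Y at *
  have hall : ∀ᵐ l ∂(volume : Measure (Fin k → EuclideanSpace ℝ (Fin N))),
      ∀ j : Fin N, ∀ᵐ x ∂μ, (x, l) ∉ pipBad k Y j := by
    rw [ae_all_iff]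
    intro j
    exact (Measure.ae_ae_comm (p := fun x l => (x, l) ∉ pipBad k Y j) (hbm j).compl).1
      (Filter.Eventually.of_forall fun x => pip_section_null Y hYH j (hbm j) x)
  filter_upwards [hall, pip_ae_linearIndependent hkN] with l hl hli
  refine ⟨hli, Y \ ⋃ j, {x | (x, l) ∈ pipBad k Y j}, sdiff_subset.trans hYX, ?_, ?_, ?_⟩
  · exact hYm.diff (MeasurableSet.iUnion fun j => measurable_prodMk_right (hbm j))
  · have h0 : μ (⋃ j, {x | (x, l) ∈ pipBad k Y j}) = 0 := by
      refine measure_iUnion_null fun j => ?_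
      have := hl j
      rw [ae_iff] at this
      simpa using this
    refine measure_mono_null ?_ (measure_union_null hKμ h0)
    intro x hx
    by_cases hxY : x ∈ Y
    · right
      by_contra hb
      exact hx.2 ⟨hxY, hb⟩
    · exact Or.inl ⟨hx.1, hxY⟩
  · rintro x ⟨hx, hxb⟩ y ⟨hy, -⟩ hxy
    by_contra hne
    apply hxb
    have : ∃ j, y j ≠ x j := by
      by_contra! hcon
      exact hne (by ext j; exact (hcon j).symm)
    obtain ⟨j, hj⟩ := this
    refine mem_iUnion.2 ⟨j, hx, y, hy, hj, fun i => ?_⟩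
    have h1 : Submodule.orthogonalProjection (Submodule.span ℝ (Set.range l)) (y - x) = 0 := by
      rw [map_sub, sub_eq_zero]; exact hxy.symm
    have h2 := Submodule.orthogonalProjectionOnto_eq_zero_iff.1 h1
    exact (Submodule.mem_orthogonal _ _).1 h2 _ (Submodule.subset_span (mem_range_self i))
end

section
/- Let X ⊆ ℝ^N be a Borel set, μ a Borel probability measure on X, and T : X → X an injective, locally Lipschitz map. Take k ∈ ℕ with k > dim_H X, and assume that for each p = 1,…,k−1 either dim_H({x ∈ X : T^p x = x}) < p or μ({x ∈ X : T^p x = x}) = 0. Let h : X → ℝ be locally Lipschitz and let h_1,…,h_m : ℝ^N → ℝ be (the evaluation functions of) a linear basis of the space of real polynomials in N variables of total degree at most 2k−1. For α = (α_1,…,α_m) ∈ ℝ^m set h_α = h + Σ_{j=1}^m α_j h_j on X. Then for Lebesgue almost every α ∈ ℝ^m there exists a Borel set X_α ⊆ X of full μ-measure such that the delay-coordinate map φ_α^T : X → ℝ^k, φ_α^T(x) = (h_α(x), h_α(Tx), …, h_α(T^{k−1}x)), is injective on X_α. -/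
open MeasureTheory Set
open scoped InnerProductSpace ENNReal

theorem ptk_ll_comp {α β γ : Type*} [PseudoEMetricSpace α] [PseudoEMetricSpace β]
    [PseudoEMetricSpace γ] {s : Set α} {f : α → β} {g : β → γ}
    (hf : LocallyLipschitzOn s f)
    (hg : ∀ y ∈ s, ∃ K, ∃ t ∈ nhdsWithin (f y) (f '' s), LipschitzOnWith K g t) :
    LocallyLipschitzOn s (fun x => g (f x)) := by
  intro y hy
  obtain ⟨K, t, ht, hK⟩ := hg y hy
  obtain ⟨K', t', ht', hK'⟩ := hf hy
  have hc : Filter.Tendsto f (nhdsWithin y s) (nhdsWithin (f y) (f '' s)) :=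
    (hf.continuousOn y hy).tendsto_nhdsWithin (mapsTo_image f s)
  refine ⟨K * K', t' ∩ f ⁻¹' t, Filter.inter_mem ht' (hc ht), ?_⟩
  exact hK.comp (hK'.mono inter_subset_left) (fun x hx => hx.2)

theorem ptk_ll_pi {α ι : Type*} [PseudoEMetricSpace α] [Fintype ι] {π : ι → Type*}
    [∀ i, PseudoEMetricSpace (π i)] {s : Set α} {f : α → ∀ i, π i}
    (hf : ∀ i, LocallyLipschitzOn s (fun x => f x i)) : LocallyLipschitzOn s f := by
  intro y hy
  choose K t ht hK using fun i => hf i hy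
  refine ⟨∑ i, K i, ⋂ i, t i, Filter.iInter_mem.2 ht, ?_⟩
  intro a ha b hb
  refine edist_pi_le_iff.2 fun i => ?_
  refine (hK i (mem_iInter.1 ha i) (mem_iInter.1 hb i)).trans ?_
  gcongr
  exact Finset.single_le_sum (f := K) (fun _ _ => zero_le) (Finset.mem_univ i)

theorem ptk_contDiffAt_det {Z : Type*} [NormedAddCommGroup Z] [NormedSpace ℝ Z] {r : ℕ}
    {M : Z → Matrix (Fin r) (Fin r) ℝ} {z0 : Z}
    (hM : ∀ a b, ContDiffAt ℝ 1 (fun z => M z a b) z0) :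
    ContDiffAt ℝ 1 (fun z => (M z).det) z0 := by
  simp only [Matrix.det_apply']
  exact ContDiffAt.sum fun σ _ => contDiffAt_const.mul (contDiffAt_prod fun i _ => hM _ _)

theorem ptk_contDiffAt_inv {Z : Type*} [NormedAddCommGroup Z] [NormedSpace ℝ Z] {r : ℕ}
    {M : Z → Matrix (Fin r) (Fin r) ℝ} {w : Z → Fin r → ℝ} {z0 : Z}
    (hM : ∀ a b, ContDiffAt ℝ 1 (fun z => M z a b) z0)
    (hw : ∀ a, ContDiffAt ℝ 1 (fun z => w z a) z0) (h0 : (M z0).det ≠ 0) :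
    ContDiffAt ℝ 1 (fun z => Matrix.mulVec (M z)⁻¹ (w z)) z0 := by
  rw [contDiffAt_pi]
  intro a
  simp only [Matrix.mulVec, dotProduct, Matrix.inv_def, Matrix.smul_apply, smul_eq_mul,
    Ring.inverse_eq_inv']
  refine ContDiffAt.sum fun i _ => (ContDiffAt.mul ?_ ?_).mul (hw i)
  · exact (ptk_contDiffAt_det hM).inv h0
  · simp only [Matrix.adjugate_apply]
    refine ptk_contDiffAt_det fun c d => ?_
    by_cases h : c = i
    · subst h; simpa using contDiffAt_const
    · simpa [Matrix.updateRow_ne h] using hM c d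

/-- the delay map, in abstract form -/
def ptkPhi {E : Type*} {k m : ℕ} (c : E → Option (Fin m) → Fin k → ℝ) (α : Fin m → ℝ) (x : E) :
    Fin k → ℝ := fun i => c x none i + ∑ j, α j * c x (some j) i

/-- the matrix of linear functionals -/
def ptkMat {E : Type*} {k m r : ℕ} (c : E → Option (Fin m) → Fin k → ℝ) (x y : E)
    (I : Fin r → Fin k) (Q : Fin r → Fin m → ℝ) : Matrix (Fin r) (Fin r) ℝ :=
  fun a b => ∑ j, Q b j * (c y (some j) (I a) - c x (some j) (I a))

theorem ptk_phi_cont {E : Type*} [TopologicalSpace E] {k m : ℕ}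
    {c : E → Option (Fin m) → Fin k → ℝ} {X : Set E} (hc : ContinuousOn c X) :
    ContinuousOn (fun p : E × (Fin m → ℝ) => ptkPhi c p.2 p.1) (X ×ˢ univ) := by
  have h1 : ContinuousOn (fun p : E × (Fin m → ℝ) => c p.1) (X ×ˢ univ) :=
    hc.comp continuousOn_fst (fun p hp => hp.1)
  have h2 : ∀ o i, ContinuousOn (fun p : E × (Fin m → ℝ) => c p.1 o i) (X ×ˢ univ) := by
    intro o i
    exact (continuousOn_pi.1 ((continuousOn_pi.1 h1) o)) i
  unfold ptkPhi
  refine continuousOn_pi.2 fun i => (h2 _ _).add (continuousOn_finsetSum _ fun j _ => ?_)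
  exact (Continuous.continuousOn (by fun_prop)).mul (h2 _ _)

theorem ptk_closed {E : Type*} [MetricSpace E] {k m : ℕ}
    {c : E → Option (Fin m) → Fin k → ℝ} {X : Set E} (hc : ContinuousOn c X)
    {K K' : Set E} (hK : IsCompact K) (hK' : IsCompact K') (hKX : K ⊆ X) (hKX' : K' ⊆ X) (δ : ℝ) :
    IsClosed {p : E × (Fin m → ℝ) | p.1 ∈ K ∧ ∃ y ∈ K', δ ≤ dist p.1 y ∧
      ptkPhi c p.2 p.1 = ptkPhi c p.2 y} := by
  have hcs : CompactSpace K' := isCompact_iff_compactSpace.1 hK'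
  let S : Set (K' × (E × (Fin m → ℝ))) :=
    {q | q.2.1 ∈ K ∧ δ ≤ dist q.2.1 (q.1 : E) ∧ ptkPhi c q.2.2 q.2.1 = ptkPhi c q.2.2 q.1}
  have hS : IsClosed S := by
    have hA : IsClosed {q : K' × (E × (Fin m → ℝ)) | q.2.1 ∈ K} :=
      hK.isClosed.preimage (by fun_prop)
    have hB : IsClosed {q : K' × (E × (Fin m → ℝ)) | δ ≤ dist q.2.1 (q.1 : E)} :=
      isClosed_le continuous_const (by fun_prop)
    have hf : ContinuousOn (fun q : K' × (E × (Fin m → ℝ)) =>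
        (ptkPhi c q.2.2 q.2.1, ptkPhi c q.2.2 q.1)) {q | q.2.1 ∈ K} := by
      refine ContinuousOn.prodMk ?_ ?_
      · exact (ptk_phi_cont hc).comp (f := fun q : K' × (E × (Fin m → ℝ)) => (q.2.1, q.2.2))
          (Continuous.continuousOn (by fun_prop)) (fun q hq => ⟨hKX hq, mem_univ _⟩)
      · exact (ptk_phi_cont hc).comp (f := fun q : K' × (E × (Fin m → ℝ)) => ((q.1 : E), q.2.2))
          (Continuous.continuousOn (by fun_prop)) (fun q hq => ⟨hKX' q.1.2, mem_univ _⟩)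
    have hC := hf.preimage_isClosed_of_isClosed hA
      (isClosed_diagonal (X := Fin k → ℝ))
    have := hC.inter hB
    convert this using 1
    ext q
    simp only [S, mem_ofPred_eq, mem_inter_iff, mem_preimage, mem_diagonal_iff]
    tauto
  have := isClosedMap_snd_of_compactSpace S hS
  convert this using 1
  ext p
  simp only [S, mem_ofPred_eq, mem_image, Prod.exists, Subtype.exists]
  constructor
  · rintro ⟨h1, y, hy, h2, h3⟩
    exact ⟨y, hy, p.1, p.2, ⟨h1, h2, h3⟩, rfl⟩
  · rintro ⟨y, hy, a, b, ⟨h1, h2, h3⟩, rfl⟩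
    exact ⟨h1, y, hy, h2, h3⟩

/-- Fubini: null along translates of a finite-dimensional family implies null. -/
theorem ptk_null_of_translates {m r : ℕ} (B : Set (Fin m → ℝ)) (hB : MeasurableSet B)
    (Q : Fin r → Fin m → ℝ)
    (h : ∀ α : Fin m → ℝ, (volume : Measure (Fin r → ℝ)) {s | α + ∑ b, s b • Q b ∈ B} = 0) :
    (volume : Measure (Fin m → ℝ)) B = 0 := by
  have hm : MeasurableSet {p : (Fin m → ℝ) × (Fin r → ℝ) | ¬ (p.1 + ∑ b, p.2 b • Q b ∈ B)} := by
    refine (MeasurableSet.preimage hB ?_).compl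
    exact Continuous.measurable (by fun_prop)
  have h1 : ∀ᵐ α ∂(volume : Measure (Fin m → ℝ)), ∀ᵐ s ∂(volume : Measure (Fin r → ℝ)),
      ¬ (α + ∑ b, s b • Q b ∈ B) := by
    refine Filter.Eventually.of_forall fun α => ?_
    rw [ae_iff]; simpa using h α
  rw [Measure.ae_ae_comm hm] at h1
  obtain ⟨s, hs⟩ := h1.exists
  rw [ae_iff] at hs
  simp only [not_not] at hs
  have := measure_preimage_add_right (volume : Measure (Fin m → ℝ)) (∑ b, s b • Q b) B
  rw [← this]; exact hs

theorem ptk_local {E : Type*} [MetricSpace E] [SecondCountableTopology E] {k m r : ℕ}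
    {c : E → Option (Fin m) → Fin k → ℝ} {X : Set E} (hc : LocallyLipschitzOn X c)
    {x : E} (hx : x ∈ X) {K : Set E} (hK : IsCompact K) (hKX : K ⊆ X) (hd : dimH K < (r : ℝ≥0∞))
    (I : Fin r → Fin k) (Q : Fin r → Fin m → ℝ)
    (hdet : ∀ y ∈ K, (ptkMat c x y I Q).det ≠ 0) :
    ∀ᵐ α ∂(volume : Measure (Fin m → ℝ)), ∀ y ∈ K, ptkPhi c α x ≠ ptkPhi c α y := by
  have hcl := ptk_closed hc.continuousOn (isCompact_singleton (x := x)) hK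
    (singleton_subset_iff.2 hx) hKX 0
  set B : Set (Fin m → ℝ) := {α | ∃ y ∈ K, ptkPhi c α x = ptkPhi c α y} with hBdef
  have hB : IsClosed B := by
    have := hcl.preimage (f := fun α : Fin m → ℝ => (x, α)) (by fun_prop)
    convert this using 1
    ext α
    simp [hBdef, dist_nonneg]
  suffices volume B = 0 by
    rw [ae_iff]; convert this using 2; ext α; simp [hBdef]
  refine ptk_null_of_translates B hB.measurableSet Q fun α => ?_
  -- the solution map
  let M : (Option (Fin m) → Fin k → ℝ) → Matrix (Fin r) (Fin r) ℝ := fun z a b =>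
    ∑ j, Q b j * (z (some j) (I a) - c x (some j) (I a))
  let w : (Option (Fin m) → Fin k → ℝ) → Fin r → ℝ := fun z a =>
    -((z none (I a) - c x none (I a)) + ∑ j, α j * (z (some j) (I a) - c x (some j) (I a)))
  let g : E → Fin r → ℝ := fun y => Matrix.mulVec (M (c y))⁻¹ (w (c y))
  have hg : LocallyLipschitzOn K g := by
    refine ptk_ll_comp (g := fun z => Matrix.mulVec (M z)⁻¹ (w z)) (hc.mono hKX) ?_
    intro y hy
    have : ContDiffAt ℝ 1 (fun z => Matrix.mulVec (M z)⁻¹ (w z)) (c y) := by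
      refine ptk_contDiffAt_inv ?_ ?_ (hdet y hy)
      · intro a b; simp only [M]; fun_prop
      · intro a; simp only [w]; fun_prop
    obtain ⟨C, t, ht, hC⟩ := this.exists_lipschitzOnWith
    exact ⟨C, t, mem_nhdsWithin_of_mem_nhds ht, hC⟩
  have hdim : dimH (g '' K) < (r : ℝ≥0∞) :=
    (dimH_image_le_of_locally_lipschitzOn fun y hy => hg hy).trans_lt hd
  have hz : volume (g '' K) = 0 := by
    have h1 := hausdorffMeasure_of_dimH_lt (d := (r : NNReal)) (by simpa using hdim)
    rw [← hausdorffMeasure_pi_real]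
    simpa using h1
  refine measure_mono_null ?_ hz
  rintro s ⟨y, hy, hxy⟩
  refine ⟨y, hy, ?_⟩
  have hu : IsUnit (M (c y)).det := isUnit_iff_ne_zero.2 (hdet y hy)
  have hMs : Matrix.mulVec (M (c y)) s = w (c y) := by
    funext a
    have := congrFun hxy (I a)
    simp only [ptkPhi, Pi.add_apply, Finset.sum_apply, Pi.smul_apply, smul_eq_mul, add_mul,
      Finset.sum_add_distrib] at this
    have e : ∀ y', ∑ j, (∑ b, s b * Q b j) * c y' (some j) (I a)
        = ∑ b, (∑ j, Q b j * c y' (some j) (I a)) * s b := by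
      intro y'
      simp only [Finset.sum_mul]
      rw [Finset.sum_comm]
      refine Finset.sum_congr rfl fun b _ => Finset.sum_congr rfl fun j _ => by ring
    rw [e x, e y] at this
    simp only [M, w, Matrix.mulVec, dotProduct, mul_sub, Finset.sum_sub_distrib, sub_mul]
    linarith
  show Matrix.mulVec (M (c y))⁻¹ (w (c y)) = s
  rw [← hMs, Matrix.mulVec_mulVec, Matrix.nonsing_inv_mul _ hu, Matrix.one_mulVec]

theorem ptk_global {E : Type*} [MetricSpace E] [SecondCountableTopology E] {k m r : ℕ}
    {c : E → Option (Fin m) → Fin k → ℝ} {X : Set E} (hc : LocallyLipschitzOn X c)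
    {x : E} (hx : x ∈ X) {K : Set E} (hK : IsCompact K) (hKX : K ⊆ X) (hd : dimH K < (r : ℝ≥0∞)) :
    ∀ᵐ α ∂(volume : Measure (Fin m → ℝ)), ∀ y ∈ K,
      (∃ (I : Fin r → Fin k) (Q : Fin r → Fin m → ℝ), (ptkMat c x y I Q).det ≠ 0) →
      ptkPhi c α x ≠ ptkPhi c α y := by
  set R : Set E := {y ∈ K | ∃ (I : Fin r → Fin k) (Q : Fin r → Fin m → ℝ),
    (ptkMat c x y I Q).det ≠ 0} with hR
  have key : ∀ y ∈ R, ∃ t ∈ nhdsWithin y R, ∀ᵐ α ∂(volume : Measure (Fin m → ℝ)),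
      ∀ z ∈ t, ptkPhi c α x ≠ ptkPhi c α z := by
    rintro y ⟨hyK, I, Q, hdet⟩
    have hcont : ContinuousOn (fun z => (ptkMat c x z I Q).det) K := by
      have hcc := hc.continuousOn.mono hKX
      have h2 : ∀ o i, ContinuousOn (fun p => c p o i) K := fun o i =>
        (continuousOn_pi.1 ((continuousOn_pi.1 hcc) o)) i
      rw [continuousOn_iff_continuous_domRestrict]
      refine Continuous.matrix_det (continuous_matrix fun a b => ?_)
      simp only [ptkMat]
      refine continuous_finsetSum _ fun j _ => continuous_const.mul (Continuous.sub ?_ continuous_const)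
      exact continuousOn_iff_continuous_domRestrict.1 (h2 (some j) (I a))
    have hev := (hcont y hyK).eventually_ne hdet
    obtain ⟨ε, hε, hsub⟩ := Metric.mem_nhdsWithin_iff.1 hev
    refine ⟨K ∩ Metric.closedBall y (ε / 2), ?_, ?_⟩
    · refine nhdsWithin_mono y (t := K) (fun z hz => hz.1) ?_
      exact Filter.inter_mem self_mem_nhdsWithin
        (mem_nhdsWithin_of_mem_nhds (Metric.closedBall_mem_nhds y (by positivity)))
    · refine ptk_local hc hx (hK.inter_right Metric.isClosed_closedBall)
        (inter_subset_left.trans hKX) ((dimH_mono inter_subset_left).trans_lt hd) I Q ?_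
      intro z hz
      refine hsub ⟨?_, hz.1⟩
      have := Metric.mem_closedBall.1 hz.2
      exact Metric.mem_ball.2 (by linarith)
  choose! t ht hta using key
  obtain ⟨S, hSR, hSc, hcov⟩ := TopologicalSpace.countable_cover_nhdsWithin ht
  have := (ae_ball_iff hSc).2 (fun y hy => hta y (hSR hy))
  filter_upwards [this] with α hα y hyK hyd
  obtain ⟨y', hy', hyy'⟩ := mem_iUnion₂.1 (hcov (show y ∈ R from ⟨hyK, hyd⟩))
  exact hα y' hy' y hyy'

theorem ptk_interp {N : ℕ} (p : EuclideanSpace ℝ (Fin N)) (S : Finset (EuclideanSpace ℝ (Fin N)))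
    (hp : p ∉ S) : ∃ P : MvPolynomial (Fin N) ℝ, P.totalDegree ≤ S.card ∧
      MvPolynomial.eval (fun n => p n) P = 1 ∧
      ∀ z ∈ S, MvPolynomial.eval (fun n => z n) P = 0 := by
  classical
  have hex : ∀ z : EuclideanSpace ℝ (Fin N), ∃ L : MvPolynomial (Fin N) ℝ, L.totalDegree ≤ 1 ∧
      (z ≠ p → MvPolynomial.eval (fun n => p n) L = 1) ∧
      MvPolynomial.eval (fun n => z n) L = 0 := by
    intro z
    by_cases hz : z = p
    · exact ⟨0, by simp, fun h => absurd hz h, by simp⟩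
    obtain ⟨n, hn⟩ : ∃ n, z n ≠ p n := by
      by_contra! hcon
      exact hz (by ext n; exact hcon n)
    refine ⟨MvPolynomial.C (p n - z n)⁻¹ * (MvPolynomial.X n - MvPolynomial.C (z n)), ?_, ?_, ?_⟩
    · refine (MvPolynomial.totalDegree_mul _ _).trans ?_
      rw [MvPolynomial.totalDegree_C, zero_add]
      refine (MvPolynomial.totalDegree_sub _ _).trans ?_
      simp
    · intro _
      have : p n - z n ≠ 0 := sub_ne_zero.2 hn.symm
      simp [this]
    · simp
  choose L hL1 hL2 hL3 using hex
  refine ⟨∏ z ∈ S, L z, ?_, ?_, ?_⟩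
  · refine (MvPolynomial.totalDegree_finsetProd _ _).trans ?_
    refine (Finset.sum_le_sum fun z _ => hL1 z).trans ?_
    simp
  · rw [map_prod]
    exact Finset.prod_eq_one fun z hz => hL2 z (fun h => hp (h ▸ hz))
  · intro z hz
    rw [map_prod]
    exact Finset.prod_eq_zero hz (hL3 z)

theorem ptk_eval_contDiff {N : ℕ} (P : MvPolynomial (Fin N) ℝ) :
    ContDiff ℝ 1 (fun x : EuclideanSpace ℝ (Fin N) => MvPolynomial.eval (fun n => x n) P) := by
  induction P using MvPolynomial.induction_on with
  | C a => simpa using contDiff_const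
  | add p q hp hq => simpa using hp.add hq
  | mul_X p n hp =>
    simp only [map_mul, MvPolynomial.eval_X]
    exact hp.mul (by fun_prop)

/-- The coefficient functions of the delay map. -/
noncomputable def ptkC {N k m : ℕ} (T : EuclideanSpace ℝ (Fin N) → EuclideanSpace ℝ (Fin N))
    (h : EuclideanSpace ℝ (Fin N) → ℝ) (f : Fin m → MvPolynomial (Fin N) ℝ)
    (x : EuclideanSpace ℝ (Fin N)) (o : Option (Fin m)) (i : Fin k) : ℝ :=
  match o with
  | none => h (T^[(i : ℕ)] x)
  | some j => MvPolynomial.eval (fun n => T^[(i : ℕ)] x n) (f j)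

theorem ptk_rank {N k m r : ℕ} (T : EuclideanSpace ℝ (Fin N) → EuclideanSpace ℝ (Fin N))
    (h : EuclideanSpace ℝ (Fin N) → ℝ)
    (b : Module.Basis (Fin m) ℝ (MvPolynomial.restrictTotalDegree (Fin N) ℝ (2 * k - 1)))
    (x y : EuclideanSpace ℝ (Fin N)) (hr : r ≤ k) (I : Fin r → Fin k)
    (hinj : ∀ a a' : Fin r, T^[(I a : ℕ)] y = T^[(I a' : ℕ)] y → a = a')
    (hne : ∀ a a' : Fin r, T^[(I a : ℕ)] y ≠ T^[(I a' : ℕ)] x) :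
    ∃ (I : Fin r → Fin k) (Q : Fin r → Fin m → ℝ),
      (ptkMat (ptkC T h (fun j => (b j : MvPolynomial (Fin N) ℝ))) x y I Q).det ≠ 0 := by
  classical
  let A : Finset (EuclideanSpace ℝ (Fin N)) := Finset.univ.image (fun a : Fin r => T^[(I a : ℕ)] y)
  let A' : Finset (EuclideanSpace ℝ (Fin N)) := Finset.univ.image (fun a : Fin r => T^[(I a : ℕ)] x)
  have hcard : ∀ a : Fin r, ((A ∪ A').erase (T^[(I a : ℕ)] y)).card ≤ 2 * k - 1 := by
    intro a
    have hmem : T^[(I a : ℕ)] y ∈ A ∪ A' := Finset.mem_union_left _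
      (Finset.mem_image.2 ⟨a, Finset.mem_univ a, rfl⟩)
    rw [Finset.card_erase_of_mem hmem]
    have h1 : A.card ≤ r := Finset.card_image_le.trans (by simp)
    have h2 : A'.card ≤ r := Finset.card_image_le.trans (by simp)
    have h3 := Finset.card_union_le A A'
    omega
  have hex : ∀ a : Fin r, ∃ q : Fin m → ℝ, ∀ z : EuclideanSpace ℝ (Fin N),
      z ∈ A ∪ A' → ∑ j, q j * MvPolynomial.eval (fun n => z n) (b j : MvPolynomial (Fin N) ℝ)
        = if z = T^[(I a : ℕ)] y then 1 else 0 := by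
    intro a
    obtain ⟨P, hP1, hP2, hP3⟩ := ptk_interp (T^[(I a : ℕ)] y)
      ((A ∪ A').erase (T^[(I a : ℕ)] y)) (Finset.notMem_erase _ _)
    let P' : MvPolynomial.restrictTotalDegree (Fin N) ℝ (2 * k - 1) :=
      ⟨P, (MvPolynomial.mem_restrictTotalDegree _ _ _).2 (hP1.trans (hcard a))⟩
    refine ⟨fun j => b.repr P' j, fun z hz => ?_⟩
    have hsum : P = ∑ j, b.repr P' j • (b j : MvPolynomial (Fin N) ℝ) := by
      have h1 : (P' : MvPolynomial (Fin N) ℝ) =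
          ((∑ j, b.repr P' j • b j : MvPolynomial.restrictTotalDegree (Fin N) ℝ (2 * k - 1)) :
            MvPolynomial (Fin N) ℝ) := by rw [b.sum_repr P']
      rw [Submodule.coe_sum] at h1
      exact h1
    have hev : ∑ j, b.repr P' j * MvPolynomial.eval (fun n => z n) (b j : MvPolynomial (Fin N) ℝ)
        = MvPolynomial.eval (fun n => z n) P := by
      conv_rhs => rw [hsum]
      simp [MvPolynomial.smul_eval]
    rw [hev]
    split_ifs with hza
    · rw [hza]; exact hP2
    · exact hP3 z (Finset.mem_erase.2 ⟨hza, hz⟩)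
  choose Q hQ using hex
  refine ⟨I, Q, ?_⟩
  have : ptkMat (ptkC T h (fun j => (b j : MvPolynomial (Fin N) ℝ))) x y I Q = 1 := by
    ext a a'
    simp only [ptkMat, ptkC, mul_sub, Finset.sum_sub_distrib]
    rw [hQ a' _ (Finset.mem_union_left _ (Finset.mem_image_of_mem _ (Finset.mem_univ a))),
      hQ a' _ (Finset.mem_union_right _ (Finset.mem_image_of_mem _ (Finset.mem_univ a))),
      if_neg (hne a' a).symm, Matrix.one_apply, sub_zero]
    by_cases haa : a = a'
    · simp [haa]
    · rw [if_neg haa, if_neg (fun e => haa (hinj _ _ e))]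
  rw [this]; simp

theorem ptk_ll_iterate {E : Type*} [PseudoEMetricSpace E] {X : Set E} {T : E → E}
    (hT : LocallyLipschitzOn X T) (hTX : MapsTo T X X) (i : ℕ) :
    LocallyLipschitzOn X T^[i] := by
  induction i with
  | zero => exact (LocallyLipschitz.id).locallyLipschitzOn
  | succ n ih =>
    have : T^[n + 1] = fun x => T (T^[n] x) := by
      funext x; exact Function.iterate_succ_apply' T n x
    rw [this]
    refine ptk_ll_comp ih fun y hy => ?_
    obtain ⟨K, t, ht, hK⟩ := hT (hTX.iterate n hy)
    exact ⟨K, t, nhdsWithin_mono _ (image_subset_iff.2 (hTX.iterate n)) ht, hK⟩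

theorem ptk_ll_of {E F : Type*} [SeminormedAddCommGroup E] [SeminormedAddCommGroup F]
    {X : Set E} {f : E → F}
    (hf : ∀ x ∈ X, ∃ U : Set E, IsOpen U ∧ x ∈ U ∧
      ∃ C > (0 : ℝ), ∀ y ∈ U ∩ X, ∀ y' ∈ U ∩ X, ‖f y - f y'‖ ≤ C * ‖y - y'‖) :
    LocallyLipschitzOn X f := by
  intro x hx
  obtain ⟨U, hU, hxU, C, hC, hl⟩ := hf x hx
  refine ⟨⟨C, hC.le⟩, U ∩ X, ?_, ?_⟩
  · exact Filter.inter_mem (mem_nhdsWithin_of_mem_nhds (hU.mem_nhds hxU)) self_mem_nhdsWithin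
  · refine LipschitzOnWith.of_dist_le_mul fun y hy y' hy' => ?_
    rw [dist_eq_norm, dist_eq_norm]
    exact hl y hy y' hy'

theorem ptk_ll_C {N k m : ℕ} {X : Set (EuclideanSpace ℝ (Fin N))}
    {T : EuclideanSpace ℝ (Fin N) → EuclideanSpace ℝ (Fin N)}
    {h : EuclideanSpace ℝ (Fin N) → ℝ} (f : Fin m → MvPolynomial (Fin N) ℝ)
    (hT : LocallyLipschitzOn X T) (hTX : MapsTo T X X) (hh : LocallyLipschitzOn X h) :
    LocallyLipschitzOn X (ptkC (k := k) T h f) := by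
  refine ptk_ll_pi fun o => ptk_ll_pi fun i => ?_
  cases o with
  | none =>
    refine ptk_ll_comp (g := h) (ptk_ll_iterate hT hTX i) fun y hy => ?_
    obtain ⟨K, t, ht, hK⟩ := hh (hTX.iterate i hy)
    exact ⟨K, t, nhdsWithin_mono _ (image_subset_iff.2 (hTX.iterate i)) ht, hK⟩
  | some j =>
    refine ptk_ll_comp (g := fun x : EuclideanSpace ℝ (Fin N) =>
      MvPolynomial.eval (fun n => x n) (f j)) (ptk_ll_iterate hT hTX i) fun y hy => ?_
    obtain ⟨K, t, ht, hK⟩ := (ptk_eval_contDiff (f j)).locallyLipschitz (T^[(i : ℕ)] y)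
    exact ⟨K, t, mem_nhdsWithin_of_mem_nhds ht, hK⟩

theorem ptk_iter_injOn {E : Type*} {X : Set E} {T : E → E} (hTX : MapsTo T X X)
    (hTinj : InjOn T X) (i : ℕ) : InjOn T^[i] X := by
  exact hTinj.iterate hTX i

/-- For a fixed point `x`, almost every parameter separates `x` from the rest of a compact set. -/
theorem ptk_fixed {N k m : ℕ}
    {X : Set (EuclideanSpace ℝ (Fin N))}
    {T : EuclideanSpace ℝ (Fin N) → EuclideanSpace ℝ (Fin N)}
    (hTX : MapsTo T X X) (hTinj : InjOn T X) (hT : LocallyLipschitzOn X T)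
    (hdim : dimH X < (k : ℝ≥0∞)) {h : EuclideanSpace ℝ (Fin N) → ℝ}
    (hh : LocallyLipschitzOn X h)
    (b : Module.Basis (Fin m) ℝ (MvPolynomial.restrictTotalDegree (Fin N) ℝ (2 * k - 1)))
    {K : Set (EuclideanSpace ℝ (Fin N))} (hK : IsCompact K) (hKX : K ⊆ X)
    (hper : ∀ p : ℕ, 1 ≤ p → p < k → dimH {x ∈ K | T^[p] x = x} < (p : ℝ≥0∞))
    {x : EuclideanSpace ℝ (Fin N)} (hx : x ∈ X) :
    ∀ᵐ α ∂(volume : Measure (Fin m → ℝ)), ∀ y ∈ K, y ≠ x →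
      ptkPhi (k := k) (ptkC T h (fun j => (b j : MvPolynomial (Fin N) ℝ))) α x ≠
        ptkPhi (ptkC T h (fun j => (b j : MvPolynomial (Fin N) ℝ))) α y := by
  have hc := ptk_ll_C (k := k) (fun j => (b j : MvPolynomial (Fin N) ℝ)) hT hTX hh
  have hk : 0 < k := by
    rcases Nat.eq_zero_or_pos k with h0 | h0
    · subst h0; simp at hdim
    · exact h0
  -- the orbit
  let O : Set (EuclideanSpace ℝ (Fin N)) := {y ∈ X | ∃ i : ℕ, T^[i] y = x ∨ T^[i] x = y}
  have hO : O.Countable := by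
    have : O ⊆ ⋃ i : ℕ, ({y ∈ X | T^[i] y = x} ∪ {T^[i] x}) := by
      rintro y ⟨hy, i, h1 | h1⟩
      · exact mem_iUnion.2 ⟨i, Or.inl ⟨hy, h1⟩⟩
      · exact mem_iUnion.2 ⟨i, Or.inr h1.symm⟩
    refine Countable.mono this (countable_iUnion fun i => Countable.union ?_ (countable_singleton _))
    refine Set.Subsingleton.countable fun y hy z hz => ?_
    exact ptk_iter_injOn hTX hTinj i hy.1 hz.1 (hy.2.trans hz.2.symm)
  have h1 := (ae_ball_iff hO).2 fun y hy => ptk_global hc hx (isCompact_singleton (x := y))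
    (singleton_subset_iff.2 hy.1) (r := 1) (by simp)
  have h2 := ptk_global hc hx hK hKX (r := k) ((dimH_mono hKX).trans_lt hdim)
  have h3 : ∀ᵐ α ∂(volume : Measure (Fin m → ℝ)), ∀ p : ℕ, 1 ≤ p → p < k →
      ∀ y ∈ {x ∈ K | T^[p] x = x},
      (∃ (I : Fin p → Fin k) (Q : Fin p → Fin m → ℝ),
        (ptkMat (ptkC T h (fun j => (b j : MvPolynomial (Fin N) ℝ))) x y I Q).det ≠ 0) →
      ptkPhi (k := k) (ptkC T h (fun j => (b j : MvPolynomial (Fin N) ℝ))) α x ≠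
        ptkPhi (ptkC T h (fun j => (b j : MvPolynomial (Fin N) ℝ))) α y := by
    rw [ae_all_iff]; intro p
    rw [ae_all_iff]; intro hp
    rw [ae_all_iff]; intro hpk
    refine ptk_global hc hx ?_ (fun y hy => hKX hy.1) (hper p hp hpk)
    have hcT : ContinuousOn (fun y => (T^[p] y, y)) K :=
      ((ptk_ll_iterate hT hTX p).continuousOn.mono hKX).prodMk continuousOn_id
    have hcl := hcT.preimage_isClosed_of_isClosed hK.isClosed
      (isClosed_diagonal (X := EuclideanSpace ℝ (Fin N)))
    exact hK.of_isClosed_subset hcl (fun y hy => hy.1)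
  filter_upwards [h1, h2, h3] with α a1 a2 a3 y hy hyx
  by_cases hyO : y ∈ O
  · refine a1 y hyO y rfl ?_
    refine ptk_rank T h b x y hk (fun _ => ⟨0, hk⟩) (fun a a' _ => Subsingleton.elim _ _) ?_
    intro a a'
    simpa using hyx
  have hyX := hKX hy
  have hne : ∀ i j : ℕ, T^[i] y ≠ T^[j] x := by
    intro i j e
    apply hyO
    refine ⟨hyX, ?_⟩
    rcases le_total i j with hij | hij
    · obtain ⟨d, rfl⟩ := Nat.exists_eq_add_of_le hij
      rw [Function.iterate_add_apply] at e
      exact ⟨d, Or.inr (ptk_iter_injOn hTX hTinj i hyX (hTX.iterate d hx) e).symm⟩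
    · obtain ⟨d, rfl⟩ := Nat.exists_eq_add_of_le hij
      rw [Function.iterate_add_apply] at e
      exact ⟨d, Or.inl (ptk_iter_injOn hTX hTinj j (hTX.iterate d hyX) hx e)⟩
  -- distinctness up to the first return
  have hdist : ∀ q : ℕ, (∀ p, 1 ≤ p → p < q → T^[p] y ≠ y) → ∀ i j : ℕ, i < q → j < q →
      T^[i] y = T^[j] y → i = j := by
    intro q hq
    have aux : ∀ i j : ℕ, i < j → j < q → T^[i] y ≠ T^[j] y := by
      intro i j hij hjq e
      obtain ⟨d, rfl⟩ := Nat.exists_eq_add_of_le hij.le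
      rw [Function.iterate_add_apply] at e
      exact hq d (by omega) (by omega)
        (ptk_iter_injOn hTX hTinj i hyX (hTX.iterate d hyX) e).symm
    intro i j hi hj e
    rcases lt_trichotomy i j with hij | hij | hij
    · exact absurd e (aux i j hij hj)
    · exact hij
    · exact absurd e.symm (aux j i hij hi)
  by_cases hP : ∃ p, 1 ≤ p ∧ p < k ∧ T^[p] y = y
  · classical
    obtain ⟨hq1, hqk, hqy⟩ := Nat.find_spec hP
    have hmin : ∀ p, p < Nat.find hP → ¬ (1 ≤ p ∧ p < k ∧ T^[p] y = y) :=
      fun p hp => Nat.find_min hP hp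
    generalize Nat.find hP = q at *
    refine a3 q hq1 hqk y ⟨hy, hqy⟩ ?_
    refine ptk_rank T h b x y hqk.le (fun a => ⟨a, a.2.trans hqk⟩) ?_ (fun a a' => hne _ _)
    intro a a' e
    exact Fin.ext (hdist q (fun p hp hpq e' => hmin p hpq ⟨hp, hpq.trans hqk, e'⟩) _ _ a.2 a'.2 e)
  · push Not at hP
    refine a2 y hy ?_
    refine ptk_rank T h b x y le_rfl id ?_ (fun a a' => hne _ _)
    intro a a' e
    exact Fin.ext (hdist k hP _ _ a.2 a'.2 e)

/-- **Probabilistic Takens delay embedding theorem (simple version).**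
`X ⊆ ℝ^N` Borel, `μ` a Borel probability measure on `X`, `T : X → X` injective and locally
Lipschitz, `k > dim_H X`, and for `p = 1,…,k−1` either `dim_H{x ∈ X : T^p x = x} < p` or
`μ{x ∈ X : T^p x = x} = 0`. Let `h : X → ℝ` be locally Lipschitz and `b` a linear basis
(indexed by `Fin m`) of the space of real polynomials in `N` variables of total degree at
most `2k−1`; `h_α = h + ∑ α_j·(b j)`. Then for Lebesgue-a.e. `α ∈ ℝ^m` there is a Borel set
`X_α ⊆ X` of full `μ`-measure on which the delay-coordinate map
`x ↦ (h_α(x), h_α(Tx), …, h_α(T^{k−1}x))` is injective. -/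
theorem probabilistic_takens_simple {N k m : ℕ}
    (X : Set (EuclideanSpace ℝ (Fin N))) (hX : MeasurableSet X)
    (μ : Measure (EuclideanSpace ℝ (Fin N))) [IsProbabilityMeasure μ]
    (hμX : μ Xᶜ = 0)
    (T : EuclideanSpace ℝ (Fin N) → EuclideanSpace ℝ (Fin N))
    (hTX : Set.MapsTo T X X) (hTinj : Set.InjOn T X)
    (hTlip : ∀ x ∈ X, ∃ U : Set (EuclideanSpace ℝ (Fin N)), IsOpen U ∧ x ∈ U ∧
      ∃ C > (0 : ℝ), ∀ y ∈ U ∩ X, ∀ y' ∈ U ∩ X, ‖T y - T y'‖ ≤ C * ‖y - y'‖)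
    (hdim : dimH X < (k : ℝ≥0∞))
    (hper : ∀ p : ℕ, 1 ≤ p → p < k →
      dimH {x ∈ X | T^[p] x = x} < (p : ℝ≥0∞) ∨ μ {x ∈ X | T^[p] x = x} = 0)
    (h : EuclideanSpace ℝ (Fin N) → ℝ)
    (hh : ∀ x ∈ X, ∃ U : Set (EuclideanSpace ℝ (Fin N)), IsOpen U ∧ x ∈ U ∧
      ∃ C > (0 : ℝ), ∀ y ∈ U ∩ X, ∀ y' ∈ U ∩ X, |h y - h y'| ≤ C * ‖y - y'‖)
    (b : Module.Basis (Fin m) ℝ (MvPolynomial.restrictTotalDegree (Fin N) ℝ (2 * k - 1))) :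
    ∀ᵐ α ∂(volume : Measure (Fin m → ℝ)),
      ∃ X_α : Set (EuclideanSpace ℝ (Fin N)), X_α ⊆ X ∧ MeasurableSet X_α ∧
        μ (X \ X_α) = 0 ∧
        Set.InjOn (fun x => fun i : Fin k =>
          h (T^[(i : ℕ)] x) +
            ∑ j, α j * MvPolynomial.eval (fun n => T^[(i : ℕ)] x n)
              ((b j : MvPolynomial (Fin N) ℝ))) X_α := by
  have hT := ptk_ll_of hTlip
  have hhl : LocallyLipschitzOn X h := ptk_ll_of hh
  have hc := ptk_ll_C (k := k) (fun j => (b j : MvPolynomial (Fin N) ℝ)) hT hTX hhl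
  -- discard the null sets of periodic points
  let Z : Set (EuclideanSpace ℝ (Fin N)) :=
    ⋃ p ∈ {p : ℕ | μ {x ∈ X | T^[p] x = x} = 0}, {x ∈ X | T^[p] x = x}
  have hZ : μ Z = 0 := (measure_biUnion_null_iff (Set.to_countable _)).2 fun p hp => hp
  let X1 := X \ toMeasurable μ Z
  have hX1 : MeasurableSet X1 := hX.diff (measurableSet_toMeasurable μ Z)
  have hex : ∀ n : ℕ, ∃ K ⊆ X1, IsCompact K ∧ μ (X1 \ K) < ((n : ℝ≥0∞) + 1)⁻¹ := fun n =>
    hX1.exists_isCompact_sdiff_lt (measure_ne_top μ _) (by simp)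
  choose K hKX1 hK hKμ using hex
  have hKX : ∀ n, K n ⊆ X := fun n => (hKX1 n).trans sdiff_subset
  have hKper : ∀ n, ∀ p : ℕ, 1 ≤ p → p < k →
      dimH {x ∈ K n | T^[p] x = x} < (p : ℝ≥0∞) := by
    intro n p hp hpk
    rcases hper p hp hpk with h1 | h1
    · exact (dimH_mono (show {x ∈ K n | T^[p] x = x} ⊆ {x ∈ X | T^[p] x = x} from
        fun x hx => ⟨hKX n hx.1, hx.2⟩)).trans_lt h1
    · have : {x ∈ K n | T^[p] x = x} = ∅ := by
        refine eq_empty_of_forall_notMem fun x hx => ?_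
        exact (hKX1 n hx.1).2 (subset_toMeasurable μ Z
          (mem_biUnion (show p ∈ {p : ℕ | μ {x ∈ X | T^[p] x = x} = 0} from h1)
            (show x ∈ {x ∈ X | T^[p] x = x} from ⟨hKX n hx.1, hx.2⟩)))
      rw [this, dimH_empty]
      exact_mod_cast hp
  have hX1K : μ (X1 \ ⋃ n, K n) = 0 := by
    refine le_antisymm (le_of_forall_gt fun ε hε => ?_) zero_le
    obtain ⟨n, hn⟩ := ENNReal.exists_inv_nat_lt hε.ne'
    calc μ (X1 \ ⋃ n, K n) ≤ μ (X1 \ K n) :=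
          measure_mono (sdiff_subset_sdiff_right (subset_iUnion K n))
      _ < ((n : ℝ≥0∞) + 1)⁻¹ := hKμ n
      _ ≤ (n : ℝ≥0∞)⁻¹ := by gcongr; exact le_self_add
      _ < ε := hn
  have main : ∀ i j n : ℕ, ∀ᵐ α ∂(volume : Measure (Fin m → ℝ)), ∀ᵐ x ∂μ,
      ¬ (x ∈ K i ∧ ∃ y ∈ K j, (1 / ((n : ℝ) + 1)) ≤ dist x y ∧
        ptkPhi (k := k) (ptkC T h (fun j => (b j : MvPolynomial (Fin N) ℝ))) α x =
          ptkPhi (ptkC T h (fun j => (b j : MvPolynomial (Fin N) ℝ))) α y) := by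
    intro i j n
    have hcl := ptk_closed hc.continuousOn (hK i) (hK j) (hKX i) (hKX j) (1 / ((n : ℝ) + 1))
    rw [← Measure.ae_ae_comm hcl.measurableSet.compl]
    refine Filter.Eventually.of_forall fun x => ?_
    by_cases hx : x ∈ K i
    · filter_upwards [ptk_fixed hTX hTinj hT hdim hhl b (hK j) (hKX j) (hKper j) (hKX i hx)]
        with α hα
      rintro ⟨-, y, hy, hd, he⟩
      refine hα y hy ?_ he
      rintro rfl
      rw [dist_self] at hd
      have : (0 : ℝ) < 1 / ((n : ℝ) + 1) := by positivity
      linarith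
    · exact Filter.Eventually.of_forall fun α hα => hx hα.1
  have main' : ∀ᵐ α ∂(volume : Measure (Fin m → ℝ)), ∀ i j n : ℕ, ∀ᵐ x ∂μ,
      ¬ (x ∈ K i ∧ ∃ y ∈ K j, (1 / ((n : ℝ) + 1)) ≤ dist x y ∧
        ptkPhi (k := k) (ptkC T h (fun j => (b j : MvPolynomial (Fin N) ℝ))) α x =
          ptkPhi (ptkC T h (fun j => (b j : MvPolynomial (Fin N) ℝ))) α y) := by
    simp only [ae_all_iff]
    exact main
  filter_upwards [main'] with α hα
  simp only [← ae_all_iff] at hα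
  rw [ae_iff] at hα
  set D := {a | ¬ ∀ i j n : ℕ, ¬ (a ∈ K i ∧ ∃ y ∈ K j, (1 / ((n : ℝ) + 1)) ≤ dist a y ∧
        ptkPhi (k := k) (ptkC T h (fun j => (b j : MvPolynomial (Fin N) ℝ))) α a =
          ptkPhi (ptkC T h (fun j => (b j : MvPolynomial (Fin N) ℝ))) α y)} with hD
  refine ⟨(⋃ n, K n) \ toMeasurable μ D, ?_, ?_, ?_, ?_⟩
  · exact sdiff_subset.trans (iUnion_subset hKX)
  · exact (MeasurableSet.iUnion fun n => (hK n).measurableSet).diff (measurableSet_toMeasurable _ _)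
  · have hsub : X \ ((⋃ n, K n) \ toMeasurable μ D) ⊆
        (toMeasurable μ Z ∪ (X1 \ ⋃ n, K n)) ∪ toMeasurable μ D := by
      rintro x ⟨hxX, hx⟩
      by_cases h1 : x ∈ toMeasurable μ Z
      · exact Or.inl (Or.inl h1)
      by_cases h2 : x ∈ ⋃ n, K n
      · by_cases h3 : x ∈ toMeasurable μ D
        · exact Or.inr h3
        · exact absurd ⟨h2, h3⟩ hx
      · exact Or.inl (Or.inr ⟨⟨hxX, h1⟩, h2⟩)
    refine measure_mono_null hsub (measure_union_null (measure_union_null ?_ hX1K) ?_)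
    · rw [measure_toMeasurable]; exact hZ
    · rw [measure_toMeasurable]; exact hα
  · rintro x ⟨hxK, hxD⟩ y ⟨hyK, -⟩ hxy
    by_contra hne
    obtain ⟨i, hi⟩ := mem_iUnion.1 hxK
    obtain ⟨j, hj⟩ := mem_iUnion.1 hyK
    obtain ⟨n, hn⟩ := exists_nat_one_div_lt (dist_pos.2 hne)
    refine hxD (subset_toMeasurable μ D ?_)
    intro hall
    exact hall i j n ⟨hi, y, hj, hn.le, hxy⟩
end
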